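/- Let n > m ≥ 1 be integers and let Ω = {x ∈ ℝ^{n+1} : 1 < ‖x‖ < 2} be the open annulus, with ∂Ω = S^n(1) ∪ S^n(2). Let f₁ and f₂ be C² maps defined on open neighborhoods of S^n(1) and S^n(2) respectively, taking values in the unit sphere S^m ⊂ ℝ^{m+1} on those spheres. Suppose the maps x ↦ f₁(x) and x ↦ f₂(2x), both from S^n(1) to S^m, are not homotopic to each other. Then there exists R₀ > 0 such that for every R ≥ R₀ there is no solution of the Dirichlet problem for the minimal surface system on Ω whose boundary data equals R·f₁ on S^n(1) and R·f₂ on S^n(2). -/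

import Mathlib

open MeasureTheory

/-- The induced metric `g_{ij} = δ_{ij} + Σ_α ∂_i F^α ∂_j F^α` of the graph of `F`
(using the a.e.-defined total `fderiv`). -/
noncomputable def mssMetric {n m : ℕ}
    (F : EuclideanSpace ℝ (Fin (n+1)) → EuclideanSpace ℝ (Fin (m+1)))
    (x : EuclideanSpace ℝ (Fin (n+1))) : Matrix (Fin (n+1)) (Fin (n+1)) ℝ :=
  fun i j => (if i = j then (1:ℝ) else 0) +
    ∑ α : Fin (m+1),
      fderiv ℝ F x (EuclideanSpace.single i 1) α * fderiv ℝ F x (EuclideanSpace.single j 1) α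

/-- `F` is a solution of the Dirichlet problem for the minimal surface system on `Ω`
with boundary data `f`: continuous on `closure Ω`, Lipschitz on `Ω`, equal to `f` on `∂Ω`,
and weakly satisfying the minimal surface system. -/
def IsMSSolution (n m : ℕ) (Ω : Set (EuclideanSpace ℝ (Fin (n+1))))
    (f F : EuclideanSpace ℝ (Fin (n+1)) → EuclideanSpace ℝ (Fin (m+1))) : Prop :=
  ContinuousOn F (closure Ω) ∧
  (∃ K : NNReal, LipschitzOnWith K F Ω) ∧
  (∀ x ∈ frontier Ω, F x = f x) ∧
  (∀ φ : EuclideanSpace ℝ (Fin (n+1)) → ℝ, ContDiff ℝ (⊤ : ℕ∞) φ → HasCompactSupport φ →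
     tsupport φ ⊆ Ω →
     (∀ j : Fin (n+1),
        ∫ x in Ω, (∑ i : Fin (n+1),
          Real.sqrt (mssMetric F x).det * (mssMetric F x)⁻¹ i j *
            fderiv ℝ φ x (EuclideanSpace.single i 1)) = 0) ∧
     (∀ α : Fin (m+1),
        ∫ x in Ω, (∑ i : Fin (n+1), ∑ j : Fin (n+1),
          Real.sqrt (mssMetric F x).det * (mssMetric F x)⁻¹ i j *
            fderiv ℝ F x (EuclideanSpace.single j 1) α *
            fderiv ℝ φ x (EuclideanSpace.single i 1)) = 0))

namespace Matrix

theorem posDef_one_add_transpose_mul_self {p q : Type*} [Fintype p] [Fintype q] [DecidableEq p]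
    (B : Matrix q p ℝ) : (1 + Bᵀ * B).PosDef := by
  have h := posSemidef_conjTranspose_mul_self B
  rw [conjTranspose_eq_transpose_of_trivial] at h
  exact PosDef.one.add_posSemidef h

/-- The trace of `Bᵀ * B * (1 + Bᵀ * B)⁻¹` is at most the number of rows of `B`. -/
theorem card_sub_trace_inv_one_add_transpose_mul_self_le {p q : Type*} [Fintype p] [Fintype q]
    [DecidableEq p] (B : Matrix q p ℝ) :
    (Fintype.card p : ℝ) - ((1 + Bᵀ * B)⁻¹).trace ≤ Fintype.card q := by
  classical
  set G := 1 + Bᵀ * B with hG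
  set H := 1 + B * Bᵀ with hH
  have hGu : IsUnit G.det := (isUnit_iff_isUnit_det _).1 (posDef_one_add_transpose_mul_self B).isUnit
  have hHpos : H.PosDef := by simpa using posDef_one_add_transpose_mul_self Bᵀ
  have hHu : IsUnit H.det := (isUnit_iff_isUnit_det _).1 hHpos.isUnit
  have hBt : Bᵀ * B = G - 1 := by rw [hG]; abel
  have hBB : B * Bᵀ = H - 1 := by rw [hH]; abel
  have hcomm : Bᵀ * H = G * Bᵀ := by
    rw [hG, hH, Matrix.mul_add, Matrix.add_mul, Matrix.mul_one, Matrix.one_mul, Matrix.mul_assoc]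
  have hkey : B * (G⁻¹ * Bᵀ) = 1 - H⁻¹ := by
    have h1 : G⁻¹ * Bᵀ = Bᵀ * H⁻¹ := by
      rw [← Matrix.mul_nonsing_inv_cancel_right H (G⁻¹ * Bᵀ) hHu, Matrix.mul_assoc G⁻¹, hcomm,
        Matrix.nonsing_inv_mul_cancel_left G _ hGu]
    rw [h1, ← Matrix.mul_assoc, hBB, Matrix.sub_mul, Matrix.mul_nonsing_inv _ hHu, Matrix.one_mul]
  have htr : (1 - G⁻¹).trace = (1 - H⁻¹).trace := by
    rw [← hkey, trace_mul_comm, Matrix.mul_assoc, hBt, Matrix.mul_sub,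
      Matrix.nonsing_inv_mul _ hGu, Matrix.mul_one]
  have hnn := hHpos.inv.posSemidef.trace_nonneg
  simp only [trace_sub, trace_one] at htr
  linarith

end Matrix

theorem mssMetric_eq {n m : ℕ} (F : EuclideanSpace ℝ (Fin (n+1)) → EuclideanSpace ℝ (Fin (m+1)))
    (x : EuclideanSpace ℝ (Fin (n+1))) (B : Matrix (Fin (m+1)) (Fin (n+1)) ℝ)
    (hB : ∀ α i, B α i = fderiv ℝ F x (EuclideanSpace.single i 1) α) :
    mssMetric F x = 1 + B.transpose * B := by
  ext i j
  simp [mssMetric, Matrix.one_apply, Matrix.mul_apply, hB]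

/-- The coefficient `√g g^{ij}` of the minimal surface system as a function of the gradient. -/
noncomputable def mssCoeff {n m : ℕ} (B : Matrix (Fin (m+1)) (Fin (n+1)) ℝ) :
    Matrix (Fin (n+1)) (Fin (n+1)) ℝ :=
  Real.sqrt (1 + B.transpose * B).det • (1 + B.transpose * B)⁻¹

theorem continuous_mssCoeff {n m : ℕ} :
    Continuous (mssCoeff : Matrix (Fin (m+1)) (Fin (n+1)) ℝ → _) := by
  have hG : Continuous fun B : Matrix (Fin (m+1)) (Fin (n+1)) ℝ => 1 + B.transpose * B := by
    fun_prop
  have : (mssCoeff : Matrix (Fin (m+1)) (Fin (n+1)) ℝ → _) =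
      fun B => Real.sqrt (1 + B.transpose * B).det •
        (((1 + B.transpose * B).det)⁻¹ • (1 + B.transpose * B).adjugate) := by
    ext1 B
    rw [mssCoeff, Matrix.inv_def, Ring.inverse_eq_inv']
  rw [this]
  exact (Real.continuous_sqrt.comp hG.matrix_det).smul
    ((hG.matrix_det.inv₀ fun B =>
      (Matrix.posDef_one_add_transpose_mul_self B).det_pos.ne').smul hG.matrix_adjugate)

theorem mssCoeff_posSemidef {n m : ℕ} (B : Matrix (Fin (m+1)) (Fin (n+1)) ℝ) :
    (mssCoeff B).PosSemidef :=
  (Matrix.posDef_one_add_transpose_mul_self B).inv.posSemidef.smul (Real.sqrt_nonneg _)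

/-- The trace inequality making `(m+2)‖x‖² - ‖F x‖²` strictly subharmonic on the graph. -/
theorem sqrt_det_le_trace_mssCoeff {n m : ℕ} (hnm : m < n)
    (B : Matrix (Fin (m+1)) (Fin (n+1)) ℝ) :
    Real.sqrt (1 + B.transpose * B).det ≤
      (m + 2) * (mssCoeff B).trace - (mssCoeff B * (B.transpose * B)).trace := by
  have h := Matrix.card_sub_trace_inv_one_add_transpose_mul_self_le B
  have hu := (Matrix.isUnit_iff_isUnit_det _).1
    (Matrix.posDef_one_add_transpose_mul_self B).isUnit
  have hBt : B.transpose * B = (1 + B.transpose * B) - 1 := by abel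
  simp only [Fintype.card_fin] at h
  push_cast at h
  set G := 1 + B.transpose * B with hG
  have hnm' : (m : ℝ) + 1 ≤ n := by exact_mod_cast hnm
  have hs := Real.sqrt_nonneg G.det
  have e : (mssCoeff B * (B.transpose * B)).trace
      = Real.sqrt G.det * ((n + 1 : ℝ) - G⁻¹.trace) := by
    rw [hBt, mssCoeff, Matrix.smul_mul, Matrix.mul_sub, Matrix.nonsing_inv_mul _ hu]
    simp [hG]
  rw [e, mssCoeff, Matrix.trace_smul, smul_eq_mul]
  have : 1 ≤ (m + 2) * G⁻¹.trace - ((n + 1 : ℝ) - G⁻¹.trace) := by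
    nlinarith [Nat.cast_nonneg (α := ℝ) m]
  nlinarith

open scoped Convolution Topology in
/-- Differentiation of the mollification of a Lipschitz function. -/
theorem ContDiffBump.hasFDerivAt_convolution_lipschitz {E : Type*} [NormedAddCommGroup E]
    [NormedSpace ℝ E] [FiniteDimensional ℝ E] [MeasurableSpace E] [BorelSpace E]
    {μ : Measure E} [μ.IsAddHaarMeasure] (ρ : ContDiffBump (0 : E)) {w : E → ℝ} {K : NNReal}
    (hw : LipschitzWith K w) (x : E) :
    HasFDerivAt (ρ.normed μ ⋆[ContinuousLinearMap.lsmul ℝ ℝ, μ] w)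
      ((ρ.normed μ ⋆[ContinuousLinearMap.lsmul ℝ ℝ, μ] fderiv ℝ w) x) x := by
  have hmp : MeasurePreserving (fun t : E => x - t) μ μ := Measure.measurePreserving_sub_left μ x
  have hd : ∀ᵐ t ∂μ, DifferentiableAt ℝ w (x - t) :=
    hmp.quasiMeasurePreserving.ae hw.ae_differentiableAt
  have hcont : ∀ y, Continuous fun t => ρ.normed μ t • w (y - t) := fun y =>
    ρ.continuous_normed.smul (hw.continuous.comp (continuous_const.sub continuous_id))
  refine (hasFDerivAt_integral_of_dominated_loc_of_lip (μ := μ)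
    (F := fun y t => ρ.normed μ t • w (y - t))
    (F' := fun t => ρ.normed μ t • fderiv ℝ w (x - t))
    (bound := fun t => ρ.normed μ t * K) (s := Set.univ) Filter.univ_mem
    (.of_forall fun y => (hcont y).aestronglyMeasurable) ?_ ?_ ?_ ?_ ?_).2
  · exact (hcont x).integrable_of_hasCompactSupport ρ.hasCompactSupport_normed.smul_right
  · exact ρ.continuous_normed.aestronglyMeasurable.smul
      ((measurable_fderiv ℝ w).comp hmp.measurable).aestronglyMeasurable
  · refine .of_forall fun t => LipschitzWith.lipschitzOnWith ?_
    refine LipschitzWith.of_dist_le_mul fun y z => ?_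
    have h0 := ρ.nonneg_normed (μ := μ) t
    have h1 := hw.dist_le_mul (y - t) (z - t)
    rw [dist_sub_right] at h1
    simp only [dist_smul₀, Real.norm_of_nonneg h0, Real.coe_nnabs,
      abs_of_nonneg (mul_nonneg h0 K.coe_nonneg)]
    rw [mul_assoc]
    exact mul_le_mul_of_nonneg_left h1 h0
  · exact ρ.integrable_normed.mul_const _
  · filter_upwards [hd] with t ht
    simpa [Function.comp_def] using
      (ht.hasFDerivAt.comp x ((hasFDerivAt_id x).sub_const t)).fun_const_smul (ρ.normed μ t)

open scoped Convolution Topology in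
/-- A first-order weak equation with bounded coefficients which holds for smooth compactly
supported test functions also holds for Lipschitz ones. -/
theorem integral_lipschitz_test_eq_zero {ι : Type*} [Fintype ι] {E : Type*} [NormedAddCommGroup E]
    [NormedSpace ℝ E] [FiniteDimensional ℝ E] [MeasurableSpace E] [BorelSpace E]
    {μ : Measure E} [μ.IsAddHaarMeasure] {Ω : Set E} (hΩ : IsOpen Ω) (hfin : μ Ω ≠ ⊤)
    (v : ι → E) (a : ι → E → ℝ) (ha : ∀ i, AEStronglyMeasurable (a i) (μ.restrict Ω))
    {M : ℝ} (hM : ∀ i, ∀ x ∈ Ω, |a i x| ≤ M)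
    (h : ∀ φ : E → ℝ, ContDiff ℝ (⊤ : ℕ∞) φ → HasCompactSupport φ → tsupport φ ⊆ Ω →
      ∫ x in Ω, ∑ i, a i x * fderiv ℝ φ x (v i) ∂μ = 0)
    {w : E → ℝ} {K : NNReal} (hw : LipschitzWith K w) {C : Set E} (hC : IsCompact C)
    (hCΩ : C ⊆ Ω) (hwC : ∀ x ∉ C, w x = 0) :
    IntegrableOn (fun x => ∑ i, a i x * fderiv ℝ w x (v i)) Ω μ ∧
      ∫ x in Ω, ∑ i, a i x * fderiv ℝ w x (v i) ∂μ = 0 := by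
  have hmeas : ∀ u : E → ℝ, AEStronglyMeasurable (fun x => ∑ i, a i x * fderiv ℝ u x (v i))
      (μ.restrict Ω) := fun u => Finset.aestronglyMeasurable_fun_sum _ fun i _ => (ha i).mul
    (measurable_fderiv_apply_const ℝ u (v i)).aestronglyMeasurable
  have hbound : ∀ u : E → ℝ, (∀ x, ‖fderiv ℝ u x‖ ≤ K) → ∀ᵐ x ∂μ.restrict Ω,
      ‖∑ i, a i x * fderiv ℝ u x (v i)‖ ≤ ∑ i, M * (K * ‖v i‖) := fun u hu => by
    refine (ae_restrict_iff' hΩ.measurableSet).2 (.of_forall fun x hx => ?_)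
    refine norm_sum_le_of_le _ fun i _ => ?_
    rw [norm_mul]
    exact mul_le_mul (hM i x hx) (ContinuousLinearMap.le_of_opNorm_le _ (hu x) _)
      (norm_nonneg _) ((abs_nonneg _).trans (hM i x hx))
  obtain ⟨δ, hδ, hδΩ⟩ := hC.exists_cthickening_subset_open hΩ hCΩ
  let ρ : ℕ → ContDiffBump (0 : E) := fun k =>
    { rIn := δ / (k + 1) / 2
      rOut := δ / (k + 1)
      rIn_pos := by positivity
      rIn_lt_rOut := by
        have : 0 < δ / ((k : ℝ) + 1) := by positivity
        linarith }
  have hρδ : ∀ k, (ρ k).rOut ≤ δ := fun k => by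
    change δ / ((k : ℝ) + 1) ≤ δ
    exact div_le_self hδ.le (by linarith [Nat.cast_nonneg (α := ℝ) k])
  let W : ℕ → E → ℝ := fun k => (ρ k).normed μ ⋆[ContinuousLinearMap.lsmul ℝ ℝ, μ] w
  have hbd : ∀ x, ‖fderiv ℝ w x‖ ≤ K := fun x => norm_fderiv_le_of_lipschitz ℝ hw
  have hWd : ∀ k x, fderiv ℝ (W k) x =
      ((ρ k).normed μ ⋆[ContinuousLinearMap.lsmul ℝ ℝ, μ] fderiv ℝ w) x :=
    fun k x => ((ρ k).hasFDerivAt_convolution_lipschitz hw x).fderiv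
  have hWbd : ∀ k x, ‖fderiv ℝ (W k) x‖ ≤ K := by
    intro k x
    rw [hWd]
    have : ∫ t, (ρ k).normed μ t * (K : ℝ) ∂μ = K := by
      rw [integral_mul_const, (ρ k).integral_normed, one_mul]
    rw [← this]
    refine norm_integral_le_of_norm_le ((ρ k).integrable_normed.mul_const _)
      (.of_forall fun t => ?_)
    have h0 := (ρ k).nonneg_normed (μ := μ) t
    rw [ContinuousLinearMap.lsmul_apply, norm_smul, Real.norm_of_nonneg h0]
    exact mul_le_mul_of_nonneg_left (hbd _) h0
  have hWsupp : ∀ k, tsupport (W k) ⊆ Metric.cthickening δ C := by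
    intro k
    refine closure_minimal ?_ Metric.isClosed_cthickening
    intro x hx
    obtain ⟨y, hy, z, hz, rfl⟩ := support_convolution_subset _ hx
    rw [(ρ k).support_normed_eq] at hy
    have hzC : z ∈ C := by by_contra hzC; exact hz (hwC z hzC)
    refine Metric.mem_cthickening_of_dist_le _ z _ _ hzC ?_
    have : ‖y‖ < (ρ k).rOut := by simpa using hy
    simpa [dist_eq_norm] using this.le.trans (hρδ k)
  have hWzero : ∀ k, ∫ x in Ω, ∑ i, a i x * fderiv ℝ (W k) x (v i) ∂μ = 0 := fun k =>
    h _ ((ρ k).hasCompactSupport_normed.contDiff_convolution_left _ (ρ k).contDiff_normed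
        hw.continuous.locallyIntegrable)
      (hC.cthickening.of_isClosed_subset (isClosed_tsupport _) (hWsupp k))
      ((hWsupp k).trans hδΩ)
  have hloc : LocallyIntegrable (fderiv ℝ w) μ := by
    refine (locallyIntegrable_const (K : ℝ)).mono
      (measurable_fderiv ℝ w).aestronglyMeasurable (.of_forall fun x => ?_)
    rw [Real.norm_of_nonneg K.coe_nonneg]
    exact hbd x
  have hlim : ∀ᵐ x ∂μ, Filter.Tendsto (fun k => fderiv ℝ (W k) x) Filter.atTop
      (𝓝 (fderiv ℝ w x)) := by
    have := ContDiffBump.ae_convolution_tendsto_right_of_locallyIntegrable (φ := ρ)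
      (l := Filter.atTop) (K := 2) ?_ ?_ hloc
    · simpa only [hWd] using this
    · change Filter.Tendsto (fun k : ℕ => δ / ((k : ℝ) + 1)) Filter.atTop (𝓝 0)
      simpa [div_eq_mul_inv] using
        (tendsto_one_div_add_atTop_nhds_zero_nat (𝕜 := ℝ)).const_mul δ
    · refine .of_forall fun k => ?_
      change δ / ((k : ℝ) + 1) ≤ 2 * (δ / (k + 1) / 2)
      linarith
  refine ⟨(integrableOn_const hfin).mono' (hmeas w) (hbound w hbd),
    tendsto_nhds_unique (tendsto_integral_of_dominated_convergence
      (fun _ => ∑ i, M * (K * ‖v i‖)) (fun k => hmeas (W k)) (integrableOn_const hfin)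
      (fun k => hbound (W k) (hWbd k)) ?_) (tendsto_const_nhds.congr fun k => (hWzero k).symm)⟩
  filter_upwards [ae_restrict_of_ae hlim] with x hx
  refine tendsto_finsetSum _ fun i _ => Filter.Tendsto.const_mul _ ?_
  exact ((ContinuousLinearMap.apply ℝ ℝ (v i)).continuous.tendsto _).comp hx

/-- A function which is Lipschitz on an open set and vanishes off a compact subset is Lipschitz. -/
theorem LipschitzOnWith.exists_lipschitzWith_of_eq_zero_off_compact {E : Type*}
    [PseudoMetricSpace E] {Ω C : Set E} (hΩ : IsOpen Ω) {w : E → ℝ} {K : NNReal}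
    (hw : LipschitzOnWith K w Ω) (hC : IsCompact C) (hCΩ : C ⊆ Ω) (hwC : ∀ x ∉ C, w x = 0) :
    ∃ K', LipschitzWith K' w := by
  have hK := K.coe_nonneg
  obtain ⟨δ, hδ, hδΩ⟩ := hC.exists_thickening_subset_open hΩ hCΩ
  obtain ⟨M, hM⟩ := hC.exists_bound_of_continuousOn (hw.continuousOn.mono hCΩ)
  have key : ∀ x ∈ C, ∀ y, dist (w x) (w y) ≤ (K + (max M 0) / δ) * dist x y := by
    intro x hx y
    have hM0 : 0 ≤ max M 0 / δ := by positivity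
    by_cases hy : y ∈ Ω
    · refine (hw.dist_le_mul x (hCΩ hx) y hy).trans ?_
      exact mul_le_mul_of_nonneg_right (by linarith) dist_nonneg
    · have hd : δ ≤ dist x y := by
        by_contra! hlt
        exact hy (hδΩ (Metric.mem_thickening_iff.2 ⟨x, hx, by rwa [dist_comm]⟩))
      rw [hwC y fun h => hy (hCΩ h), dist_zero_right]
      calc ‖w x‖ ≤ max M 0 := (hM x hx).trans (le_max_left _ _)
        _ = max M 0 / δ * δ := by field_simp
        _ ≤ (K + (max M 0) / δ) * dist x y := by
          refine mul_le_mul ?_ hd hδ.le (by positivity)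
          linarith [K.2]
  refine ⟨⟨K + max M 0 / δ, by positivity⟩, LipschitzWith.of_dist_le_mul fun x y => ?_⟩
  by_cases hx : x ∈ C
  · exact key x hx y
  by_cases hy : y ∈ C
  · rw [dist_comm, dist_comm x]; exact key y hy x
  · rw [hwC x hx, hwC y hy, dist_self]
    exact mul_nonneg NNReal.zero_le_coe dist_nonneg

/-- The product of two bounded Lipschitz functions is Lipschitz. -/
theorem LipschitzOnWith.exists_mul_of_bounded {E : Type*} [PseudoMetricSpace E] {Ω : Set E}
    {f g : E → ℝ} {Kf Kg : NNReal} (hf : LipschitzOnWith Kf f Ω) (hg : LipschitzOnWith Kg g Ω)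
    {Mf Mg : ℝ} (hMf : ∀ x ∈ Ω, |f x| ≤ Mf) (hMg : ∀ x ∈ Ω, |g x| ≤ Mg) :
    ∃ K, LipschitzOnWith K (fun x => f x * g x) Ω := by
  refine ⟨Real.toNNReal Mf * Kg + Kf * Real.toNNReal Mg,
    LipschitzOnWith.of_dist_le_mul fun x hx y hy => ?_⟩
  have h1 := hf.dist_le_mul x hx y hy
  have h2 := hg.dist_le_mul x hx y hy
  rw [Real.dist_eq] at h1 h2 ⊢
  have hMf0 : 0 ≤ Mf := (abs_nonneg _).trans (hMf x hx)
  have hMg0 : 0 ≤ Mg := (abs_nonneg _).trans (hMg x hx)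
  push_cast
  rw [Real.coe_toNNReal _ hMf0, Real.coe_toNNReal _ hMg0]
  calc |f x * g x - f y * g y| = |f x * (g x - g y) + (f x - f y) * g y| := by congr 1; ring
    _ ≤ |f x| * |g x - g y| + |f x - f y| * |g y| := by
      refine (abs_add_le _ _).trans ?_
      rw [abs_mul, abs_mul]
    _ ≤ Mf * (Kg * dist x y) + (Kf * dist x y) * Mg := by
      gcongr
      · exact hMf x hx
      · exact hMg y hy
    _ = _ := by ring

/-- The Jacobian matrix of a linear map between Euclidean spaces. -/
noncomputable def jacobianMatrix {n m : ℕ}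
    (L : EuclideanSpace ℝ (Fin (n+1)) →L[ℝ] EuclideanSpace ℝ (Fin (m+1))) :
    Matrix (Fin (m+1)) (Fin (n+1)) ℝ :=
  Matrix.of fun α i => L (EuclideanSpace.single i 1) α

theorem continuous_jacobianMatrix {n m : ℕ} :
    Continuous (jacobianMatrix (n := n) (m := m)) := by
  refine continuous_matrix fun α i => ?_
  simp only [jacobianMatrix, Matrix.of_apply]
  fun_prop

theorem sqrt_det_mul_inv_mssMetric {n m : ℕ}
    (F : EuclideanSpace ℝ (Fin (n+1)) → EuclideanSpace ℝ (Fin (m+1)))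
    (x : EuclideanSpace ℝ (Fin (n+1))) (i j : Fin (n+1)) :
    Real.sqrt (mssMetric F x).det * (mssMetric F x)⁻¹ i j =
      mssCoeff (jacobianMatrix (fderiv ℝ F x)) i j := by
  rw [mssMetric_eq F x (jacobianMatrix (fderiv ℝ F x)) fun _ _ => rfl]
  rfl

theorem LipschitzOnWith.exists_bound_comp_fderiv {E E' : Type*} [NormedAddCommGroup E]
    [NormedSpace ℝ E] [FiniteDimensional ℝ E] [NormedAddCommGroup E'] [NormedSpace ℝ E']
    [FiniteDimensional ℝ E'] {F : E → E'} {Ω : Set E} {K : NNReal} (hF : LipschitzOnWith K F Ω)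
    (hΩ : IsOpen Ω) {Ψ : (E →L[ℝ] E') → ℝ} (hΨ : Continuous Ψ) :
    ∃ M, ∀ x ∈ Ω, |Ψ (fderiv ℝ F x)| ≤ M := by
  have : ProperSpace (E →L[ℝ] E') := FiniteDimensional.proper ℝ _
  obtain ⟨M, hM⟩ := (isCompact_closedBall (0 : E →L[ℝ] E') K).exists_bound_of_continuousOn
    hΨ.continuousOn
  exact ⟨M, fun x hx => hM _ (mem_closedBall_zero_iff.2
    (norm_fderiv_le_of_lipschitzOn ℝ (hΩ.mem_nhds hx) hF))⟩

/-- Pointwise lower bound for the integrand obtained from the minimal surface system with the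
test functions `x j * φ` and `F α * φ`. Here `p` is the gradient of `φ`, which either vanishes or
is the gradient of `(m+2)‖x‖² - ‖F x‖²`. -/
theorem mul_sqrt_det_le_mss_integrand {n m : ℕ} (hnm : m < n)
    (B : Matrix (Fin (m+1)) (Fin (n+1)) ℝ) (x p : Fin (n+1) → ℝ) (y : Fin (m+1) → ℝ) {t : ℝ}
    (ht : 0 ≤ t) (hp : p = 0 ∨ ∀ j, p j = 2 * ((m + 2) * x j - ∑ α, y α * B α j)) :
    t * Real.sqrt (1 + B.transpose * B).det ≤
      (m + 2) * (∑ j, ∑ i, mssCoeff B i j * ((if i = j then 1 else 0) * t + x j * p i)) -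
        ∑ α, ∑ i, (∑ j, mssCoeff B i j * B α j) * (B α i * t + y α * p i) := by
  set c := mssCoeff B
  set q : Fin (n+1) → ℝ := fun j => (m + 2) * x j - ∑ α, y α * B α j with hq
  have e1 : ∑ j, ∑ i, c i j * ((if i = j then 1 else 0) * t + x j * p i) =
      t * c.trace + ∑ i, ∑ j, c i j * p i * x j := by
    rw [Finset.sum_comm (f := fun i j => c i j * p i * x j), Matrix.trace, Finset.mul_sum,
      ← Finset.sum_add_distrib]
    refine Finset.sum_congr rfl fun j _ => ?_
    simp only [mul_add, Finset.sum_add_distrib]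
    congr 1
    · simp [mul_comm]
    · exact Finset.sum_congr rfl fun i _ => by ring
  have e2 : ∑ α, ∑ i, (∑ j, c i j * B α j) * (B α i * t + y α * p i) =
      t * (c * (B.transpose * B)).trace + ∑ i, ∑ j, c i j * p i * ∑ α, y α * B α j := by
    simp only [Matrix.trace, Matrix.diag, Matrix.mul_apply, Matrix.transpose_apply,
      Finset.mul_sum, Finset.sum_mul]
    rw [Finset.sum_comm, ← Finset.sum_add_distrib]
    refine Finset.sum_congr rfl fun i _ => ?_
    rw [Finset.sum_comm, ← Finset.sum_add_distrib]
    refine Finset.sum_congr rfl fun j _ => ?_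
    rw [← Finset.sum_add_distrib]
    exact Finset.sum_congr rfl fun α _ => by ring
  have e3 : 0 ≤ ∑ i, ∑ j, c i j * p i * q j := by
    rcases hp with rfl | hp
    · simp
    · have h := (mssCoeff_posSemidef B).dotProduct_mulVec_nonneg q
      have : ∑ i, ∑ j, c i j * p i * q j = 2 * (star q ⬝ᵥ (c.mulVec q)) := by
        simp only [dotProduct, Matrix.mulVec, Finset.mul_sum, hp, star_trivial]
        refine Finset.sum_congr rfl fun i _ => Finset.sum_congr rfl fun j _ => ?_
        simp only [hq]; ring
      rw [this]; positivity
  have e4 : ∑ i, ∑ j, c i j * p i * q j = (m + 2) * (∑ i, ∑ j, c i j * p i * x j) -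
      ∑ i, ∑ j, c i j * p i * ∑ α, y α * B α j := by
    simp only [hq, Finset.mul_sum (s := Finset.univ) (a := (m + 2 : ℝ)), ← Finset.sum_sub_distrib]
    exact Finset.sum_congr rfl fun i _ => Finset.sum_congr rfl fun j _ => by ring
  have e5 := mul_le_mul_of_nonneg_left (sqrt_det_le_trace_mssCoeff hnm B) ht
  rw [e1, e2]
  linarith

theorem fderiv_coord_mul_apply {E : Type*} [NormedAddCommGroup E] [NormedSpace ℝ E] {k : ℕ}
    {F : E → EuclideanSpace ℝ (Fin k)} {φ : E → ℝ} {x : E} (hF : DifferentiableAt ℝ F x)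
    (hφ : DifferentiableAt ℝ φ x) (α : Fin k) (v : E) :
    fderiv ℝ (fun y => F y α * φ y) x v = fderiv ℝ F x v α * φ x + F x α * fderiv ℝ φ x v := by
  have h := (((EuclideanSpace.proj (𝕜 := ℝ) α).hasFDerivAt).comp x hF.hasFDerivAt).fun_mul
    hφ.hasFDerivAt
  refine (congrArg (fun D => D v) h.fderiv).trans ?_
  simp [mul_comm, add_comm]

theorem fderiv_const_mul_norm_sq_sub_norm_sq {k l : ℕ}
    {F : EuclideanSpace ℝ (Fin k) → EuclideanSpace ℝ (Fin l)} {x : EuclideanSpace ℝ (Fin k)}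
    (hF : DifferentiableAt ℝ F x) (c : ℝ) (j : Fin k) :
    fderiv ℝ (fun y => c * ‖y‖ ^ 2 - ‖F y‖ ^ 2) x (EuclideanSpace.single j 1) =
      2 * (c * x j - ∑ α, F x α * fderiv ℝ F x (EuclideanSpace.single j 1) α) := by
  have h := (((hasFDerivAt_id x).norm_sq).const_mul c).sub hF.hasFDerivAt.norm_sq
  refine (congrArg (fun D => D (EuclideanSpace.single j 1)) h.fderiv).trans ?_
  simp [PiLp.inner_apply, mul_comm ((F x).ofLp _)]
  ring

/-- Maximum principle for `(m+2)‖x‖² - ‖F x‖²` along a solution of the minimal surface system. -/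
theorem IsMSSolution.mul_norm_sq_le {n m : ℕ} (hnm : m < n)
    {Ω : Set (EuclideanSpace ℝ (Fin (n+1)))} (hΩ : IsOpen Ω) (hbdd : Bornology.IsBounded Ω)
    {f F : EuclideanSpace ℝ (Fin (n+1)) → EuclideanSpace ℝ (Fin (m+1))}
    (hF : IsMSSolution n m Ω f F)
    (hfr : ∀ x ∈ frontier Ω, (m + 2) * ‖x‖ ^ 2 < ‖f x‖ ^ 2) :
    ∀ x ∈ Ω, (m + 2) * ‖x‖ ^ 2 ≤ ‖F x‖ ^ 2 := by
  obtain ⟨hFc, ⟨K, hFK⟩, hFf, hweak⟩ := hF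
  set u : EuclideanSpace ℝ (Fin (n+1)) → ℝ := fun x => (m + 2) * ‖x‖ ^ 2 - ‖F x‖ ^ 2 with hu
  have hcl : IsCompact (closure Ω) := hbdd.isCompact_closure
  have hucont : ContinuousOn u (closure Ω) :=
    ((continuous_norm.pow 2).const_mul _).continuousOn.sub (hFc.norm.pow 2)
  set C := closure Ω ∩ u ⁻¹' Set.Ici 0
  have hC : IsCompact C := hcl.of_isClosed_subset
    (hucont.preimage_isClosed_of_isClosed isClosed_closure isClosed_Ici) Set.inter_subset_left
  have hCΩ : C ⊆ Ω := by
    rintro x ⟨hx, hx0⟩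
    by_contra hxΩ
    have hxf : x ∈ frontier Ω := ⟨hx, by rwa [hΩ.interior_eq]⟩
    have h1 := hfr x hxf
    have h2 : 0 ≤ (m + 2) * ‖x‖ ^ 2 - ‖F x‖ ^ 2 := hx0
    rw [hFf x hxf] at h2
    linarith
  set φ := C.indicator u with hφ
  have hφC : ∀ x ∉ C, φ x = 0 := fun x hx => Set.indicator_of_notMem hx u
  have hφmax : ∀ x ∈ Ω, φ x = max (u x) 0 := fun x hx => by
    by_cases h : x ∈ C
    · rw [hφ, Set.indicator_of_mem h, max_eq_left h.2]
    · rw [hφC x h, max_eq_right]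
      by_contra! h'
      exact h ⟨subset_closure hx, h'.le⟩
  have hφ0 : ∀ x, 0 ≤ φ x := fun x => Set.indicator_nonneg (fun x hx => hx.2) x
  -- Lipschitz bounds
  obtain ⟨M₁, hM₁⟩ := hcl.exists_bound_of_continuousOn (f := fun x => x) continuousOn_id
  obtain ⟨M₂, hM₂⟩ := hcl.exists_bound_of_continuousOn hFc
  replace hM₁ : ∀ x ∈ Ω, ‖x‖ ≤ M₁ := fun x hx => hM₁ x (subset_closure hx)
  replace hM₂ : ∀ x ∈ Ω, ‖F x‖ ≤ M₂ := fun x hx => hM₂ x (subset_closure hx)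
  have hφL : ∃ L, LipschitzOnWith L φ Ω := by
    obtain ⟨L₁, hL₁⟩ := (lipschitzWith_one_norm.lipschitzOnWith (s := Ω)).exists_mul_of_bounded
      lipschitzWith_one_norm.lipschitzOnWith (Mf := M₁) (Mg := M₁)
      (by simpa using hM₁) (by simpa using hM₁)
    have hFn : LipschitzOnWith (1 * K) (fun x => ‖F x‖) Ω :=
      lipschitzWith_one_norm.comp_lipschitzOnWith hFK
    obtain ⟨L₂, hL₂⟩ := hFn.exists_mul_of_bounded hFn (Mf := M₂) (Mg := M₂)
      (by simpa using hM₂) (by simpa using hM₂)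
    refine ⟨(m + 2) * L₁ + L₂, LipschitzOnWith.of_dist_le_mul fun x hx y hy => ?_⟩
    have h1 := hL₁.dist_le_mul x hx y hy
    have h2 := hL₂.dist_le_mul x hx y hy
    rw [hφmax x hx, hφmax y hy]
    rw [Real.dist_eq] at h1 h2 ⊢
    refine (abs_max_sub_max_le_abs _ _ _).trans ?_
    have : u x - u y = (m + 2) * (‖x‖ * ‖x‖ - ‖y‖ * ‖y‖) - (‖F x‖ * ‖F x‖ - ‖F y‖ * ‖F y‖) := by
      simp only [hu]; ring
    rw [this]
    refine (abs_sub _ _).trans ?_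
    rw [abs_mul, abs_of_nonneg (by positivity : (0 : ℝ) ≤ m + 2)]
    push_cast
    have h3 := mul_le_mul_of_nonneg_left h1 (by positivity : (0 : ℝ) ≤ m + 2)
    linarith
  obtain ⟨L, hL⟩ := hφL
  obtain ⟨M, hM⟩ := hC.exists_bound_of_continuousOn (hL.continuousOn.mono hCΩ)
  have hφM : ∀ x ∈ Ω, |φ x| ≤ max M 0 := fun x _ => by
    by_cases h : x ∈ C
    · exact (hM x h).trans (le_max_left _ _)
    · rw [hφC x h, abs_zero]; exact le_max_right _ _
  obtain ⟨Lφ, hLφ⟩ := hL.exists_lipschitzWith_of_eq_zero_off_compact hΩ hC hCΩ hφC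
  have hcoord : ∀ (N : ℕ) (j : Fin N), LipschitzWith 1 fun y : EuclideanSpace ℝ (Fin N) => y j :=
    fun N j => LipschitzWith.of_dist_le_mul fun y z => by
      rw [NNReal.coe_one, one_mul, dist_eq_norm, dist_eq_norm]
      exact PiLp.norm_apply_le (y - z) j
  have hw₁ : ∀ j, ∃ K', LipschitzWith K' fun x => x j * φ x := fun j => by
    obtain ⟨K', hK'⟩ := ((hcoord _ j).lipschitzOnWith (s := Ω)).exists_mul_of_bounded hL
      (fun x hx => (PiLp.norm_apply_le x j).trans (hM₁ x hx)) hφM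
    exact hK'.exists_lipschitzWith_of_eq_zero_off_compact hΩ hC hCΩ fun x hx => by simp [hφC x hx]
  have hw₂ : ∀ α, ∃ K', LipschitzWith K' fun x => F x α * φ x := fun α => by
    obtain ⟨K', hK'⟩ := ((hcoord _ α).comp_lipschitzOnWith hFK).exists_mul_of_bounded hL
      (fun x hx => (PiLp.norm_apply_le (F x) α).trans (hM₂ x hx)) hφM
    exact hK'.exists_lipschitzWith_of_eq_zero_off_compact hΩ hC hCΩ fun x hx => by simp [hφC x hx]
  -- the weak equations for the two families of test functions
  have hfin : volume Ω ≠ ⊤ := hbdd.measure_lt_top.ne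
  let B := fun x => jacobianMatrix (fderiv ℝ F x)
  let v : Fin (n+1) → EuclideanSpace ℝ (Fin (n+1)) := fun i => EuclideanSpace.single i 1
  have hcj : ∀ i j, Continuous fun D : EuclideanSpace ℝ (Fin (n+1)) →L[ℝ]
      EuclideanSpace ℝ (Fin (m+1)) => mssCoeff (jacobianMatrix D) i j := fun i j =>
    (continuous_mssCoeff.comp continuous_jacobianMatrix).matrix_elem i j
  have hcj' : ∀ i α, Continuous fun D : EuclideanSpace ℝ (Fin (n+1)) →L[ℝ]
      EuclideanSpace ℝ (Fin (m+1)) => ∑ j, mssCoeff (jacobianMatrix D) i j *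
        jacobianMatrix D α j := fun i α =>
    continuous_finsetSum _ fun j _ => (hcj i j).mul (continuous_jacobianMatrix.matrix_elem α j)
  have hI₁ : ∀ j, IntegrableOn (fun x => ∑ i, mssCoeff (B x) i j *
        fderiv ℝ (fun x => x j * φ x) x (v i)) Ω ∧
      ∫ x in Ω, ∑ i, mssCoeff (B x) i j * fderiv ℝ (fun x => x j * φ x) x (v i) = 0 := by
    intro j
    obtain ⟨K', hK'⟩ := hw₁ j
    choose N hN using fun i => hFK.exists_bound_comp_fderiv hΩ (hcj i j)
    refine integral_lipschitz_test_eq_zero hΩ hfin v (fun i x => mssCoeff (B x) i j)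
      (fun i => ((hcj i j).measurable.comp (measurable_fderiv ℝ F)).aestronglyMeasurable)
      (M := ∑ i, |N i|)
      (fun i x hx => (hN i x hx).trans ((le_abs_self _).trans
        (Finset.single_le_sum (f := fun i => |N i|) (fun _ _ => abs_nonneg _)
          (Finset.mem_univ i))))
      (fun ψ h1 h2 h3 => ?_) hK' hC hCΩ fun x hx => by simp [hφC x hx]
    simpa only [sqrt_det_mul_inv_mssMetric] using (hweak ψ h1 h2 h3).1 j
  have hI₂ : ∀ α, IntegrableOn (fun x => ∑ i, (∑ j, mssCoeff (B x) i j * B x α j) *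
        fderiv ℝ (fun x => F x α * φ x) x (v i)) Ω ∧
      ∫ x in Ω, ∑ i, (∑ j, mssCoeff (B x) i j * B x α j) *
        fderiv ℝ (fun x => F x α * φ x) x (v i) = 0 := by
    intro α
    obtain ⟨K', hK'⟩ := hw₂ α
    choose N hN using fun i => hFK.exists_bound_comp_fderiv hΩ (hcj' i α)
    refine integral_lipschitz_test_eq_zero hΩ hfin v
      (fun i x => ∑ j, mssCoeff (B x) i j * B x α j)
      (fun i => ((hcj' i α).measurable.comp (measurable_fderiv ℝ F)).aestronglyMeasurable)
      (M := ∑ i, |N i|)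
      (fun i x hx => (hN i x hx).trans ((le_abs_self _).trans
        (Finset.single_le_sum (f := fun i => |N i|) (fun _ _ => abs_nonneg _)
          (Finset.mem_univ i))))
      (fun ψ h1 h2 h3 => ?_) hK' hC hCΩ fun x hx => by simp [hφC x hx]
    have h := (hweak ψ h1 h2 h3).2 α
    simp only [sqrt_det_mul_inv_mssMetric] at h
    simp only [Finset.sum_mul]
    exact h
  set J : EuclideanSpace ℝ (Fin (n+1)) → ℝ := fun x =>
    (m + 2) * (∑ j, ∑ i, mssCoeff (B x) i j * fderiv ℝ (fun x => x j * φ x) x (v i)) -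
      ∑ α, ∑ i, (∑ j, mssCoeff (B x) i j * B x α j) *
        fderiv ℝ (fun x => F x α * φ x) x (v i) with hJ
  have hint₁ := (integrable_finsetSum Finset.univ fun j _ => (hI₁ j).1).const_mul (m + 2 : ℝ)
  have hint₂ := integrable_finsetSum Finset.univ fun α _ => (hI₂ α).1
  have hJint : IntegrableOn J Ω := hint₁.sub hint₂
  have hJ0 : ∫ x in Ω, J x = 0 := by
    rw [hJ, integral_sub hint₁ hint₂, integral_const_mul,
      integral_finsetSum _ fun j _ => (hI₁ j).1, integral_finsetSum _ fun j _ => (hI₂ j).1]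
    simp only [fun j => (hI₁ j).2, fun α => (hI₂ α).2]
    simp
  -- pointwise lower bound
  have hFd : ∀ᵐ x ∂volume.restrict Ω, DifferentiableAt ℝ F x := by
    refine (ae_restrict_iff' hΩ.measurableSet).2 ?_
    filter_upwards [hFK.ae_differentiableWithinAt_of_mem] with x hx hxΩ
    exact (hx hxΩ).differentiableAt (hΩ.mem_nhds hxΩ)
  have hJlow : ∀ᵐ x ∂volume.restrict Ω,
      φ x * Real.sqrt (1 + (B x).transpose * B x).det ≤ J x := by
    filter_upwards [hFd, ae_restrict_of_ae hLφ.ae_differentiableAt,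
      ae_restrict_mem hΩ.measurableSet] with x hFx hφx hxΩ
    have h := mul_sqrt_det_le_mss_integrand hnm (B x) x (fun i => fderiv ℝ φ x (v i)) (F x)
      (hφ0 x) ?_
    · refine h.trans_eq ?_
      have d1 : ∀ i j, fderiv ℝ (fun x => x j * φ x) x (v i) =
          (if i = j then 1 else 0) * φ x + x j * fderiv ℝ φ x (v i) := fun i j => by
        rw [fderiv_coord_mul_apply (F := fun y => y) differentiableAt_id hφx, fderiv_fun_id]
        simp [v, eq_comm]
      have d2 : ∀ i α, fderiv ℝ (fun x => F x α * φ x) x (v i) =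
          B x α i * φ x + F x α * fderiv ℝ φ x (v i) := fun i α =>
        fderiv_coord_mul_apply hFx hφx α (v i)
      simp only [hJ, d1, d2]
    · rcases le_or_gt (u x) 0 with hux | hux
      · left
        have hx0 : φ x = 0 := by rw [hφmax x hxΩ, max_eq_right hux]
        have : IsLocalMin φ x := .of_forall fun y => by rw [hx0]; exact hφ0 y
        ext i
        simp [this.fderiv_eq_zero]
      · right
        intro j
        have hev : φ =ᶠ[nhds x] u := by
          have := (hucont.continuousAt (Filter.mem_of_superset (hΩ.mem_nhds hxΩ)
            subset_closure)).eventually (lt_mem_nhds hux)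
          filter_upwards [this, hΩ.mem_nhds hxΩ] with y hy hyΩ
          rw [hφmax y hyΩ, max_eq_left hy.le]
        change fderiv ℝ φ x (v j) = _
        rw [hev.fderiv_eq]
        exact fderiv_const_mul_norm_sq_sub_norm_sq hFx (m + 2) j
  have hsq : ∀ x, 0 < Real.sqrt (1 + (B x).transpose * B x).det := fun x =>
    Real.sqrt_pos.2 (Matrix.posDef_one_add_transpose_mul_self (B x)).det_pos
  have hJnn : 0 ≤ᵐ[volume.restrict Ω] J := hJlow.mono fun x hx =>
    (mul_nonneg (hφ0 x) (hsq x).le).trans hx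
  have hJae := (integral_eq_zero_iff_of_nonneg_ae hJnn hJint).1 hJ0
  have hae : ∀ᵐ x ∂volume.restrict Ω, u x ≤ 0 := by
    filter_upwards [hJae, hJlow, ae_restrict_mem hΩ.measurableSet] with x h1 h2 hx
    rw [h1, Pi.zero_apply] at h2
    have h3 := nonpos_of_mul_nonpos_left h2 (hsq x)
    rw [hφmax x hx] at h3
    exact (le_max_left _ _).trans h3
  by_contra! hcon
  obtain ⟨x₀, hx₀, hpos⟩ := hcon
  have hopen : IsOpen (Ω ∩ u ⁻¹' Set.Ioi 0) :=
    (hucont.mono subset_closure).isOpen_inter_preimage hΩ isOpen_Ioi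
  have hne : (Ω ∩ u ⁻¹' Set.Ioi 0).Nonempty := ⟨x₀, hx₀, sub_pos.2 hpos⟩
  refine (hopen.measure_pos volume hne).ne' ?_
  rw [ae_restrict_iff' hΩ.measurableSet, ae_iff] at hae
  refine measure_mono_null ?_ hae
  rintro x ⟨hx, hx'⟩ h
  exact absurd (h hx) (not_le.2 hx')

theorem isOpen_annulus {E : Type*} [NormedAddCommGroup E] :
    IsOpen {x : E | 1 < ‖x‖ ∧ ‖x‖ < 2} :=
  (isOpen_lt continuous_const continuous_norm).inter (isOpen_lt continuous_norm continuous_const)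

theorem smul_mem_closure_annulus {E : Type*} [NormedAddCommGroup E] [NormedSpace ℝ E] {x : E}
    (hx : ‖x‖ = 1) {t : ℝ} (ht : t ∈ Set.Icc (1 : ℝ) 2) :
    t • x ∈ closure {x : E | 1 < ‖x‖ ∧ ‖x‖ < 2} := by
  rw [← closure_Ioo (by norm_num : (1 : ℝ) ≠ 2)] at ht
  refine map_mem_closure (f := fun t : ℝ => t • x) (by fun_prop) ht fun s hs => ?_
  have hs0 : (0 : ℝ) < s := zero_lt_one.trans hs.1
  simpa [norm_smul, hx, abs_of_pos hs0] using hs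

theorem norm_eq_of_mem_frontier_annulus {E : Type*} [NormedAddCommGroup E] {x : E}
    (hx : x ∈ frontier {x : E | 1 < ‖x‖ ∧ ‖x‖ < 2}) : ‖x‖ = 1 ∨ ‖x‖ = 2 := by
  rw [isOpen_annulus.frontier_eq] at hx
  have hsub : {x : E | 1 < ‖x‖ ∧ ‖x‖ < 2} ⊆ {x : E | 1 ≤ ‖x‖ ∧ ‖x‖ ≤ 2} :=
    fun y hy => ⟨hy.1.le, hy.2.le⟩
  have hclosed : IsClosed {x : E | 1 ≤ ‖x‖ ∧ ‖x‖ ≤ 2} :=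
    (isClosed_le continuous_const continuous_norm).inter
      (isClosed_le continuous_norm continuous_const)
  have hcl := closure_minimal hsub hclosed hx.1
  by_contra! h
  exact hx.2 ⟨lt_of_le_of_ne hcl.1 h.1.symm, lt_of_le_of_ne hcl.2 h.2⟩

/-- A nowhere vanishing continuous map on the closed annulus gives, after normalisation, a homotopy
between its restrictions to the two boundary spheres. -/
theorem homotopic_of_ne_zero_on_annulus {E E' : Type*} [NormedAddCommGroup E] [NormedSpace ℝ E]
    [NormedAddCommGroup E'] [NormedSpace ℝ E'] {F : E → E'}
    (hF : ContinuousOn F (closure {x : E | 1 < ‖x‖ ∧ ‖x‖ < 2}))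
    (hF0 : ∀ x ∈ closure {x : E | 1 < ‖x‖ ∧ ‖x‖ < 2}, F x ≠ 0) :
    ∃ g₁ g₂ : C(Metric.sphere (0 : E) 1, Metric.sphere (0 : E') 1),
      (∀ x, (g₁ x : E') = ‖F x‖⁻¹ • F x) ∧
      (∀ x, (g₂ x : E') = ‖F ((2 : ℝ) • (x : E))‖⁻¹ • F ((2 : ℝ) • (x : E))) ∧
      g₁.Homotopic g₂ := by
  have hmem : ∀ p : unitInterval × Metric.sphere (0 : E) 1,
      (1 + (p.1 : ℝ)) • (p.2 : E) ∈ closure {x : E | 1 < ‖x‖ ∧ ‖x‖ < 2} := fun p =>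
    smul_mem_closure_annulus (by simp) ⟨by linarith [p.1.2.1], by linarith [p.1.2.2]⟩
  have hc : Continuous fun p : unitInterval × Metric.sphere (0 : E) 1 =>
      F ((1 + (p.1 : ℝ)) • (p.2 : E)) := hF.comp_continuous (by fun_prop) hmem
  have hn : ∀ p : unitInterval × Metric.sphere (0 : E) 1,
      ‖F ((1 + (p.1 : ℝ)) • (p.2 : E))‖⁻¹ • F ((1 + (p.1 : ℝ)) • (p.2 : E)) ∈
        Metric.sphere (0 : E') 1 := fun p => by
    rw [mem_sphere_zero_iff_norm, norm_smul, norm_inv, norm_norm,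
      inv_mul_cancel₀ (norm_ne_zero_iff.2 (hF0 _ (hmem p)))]
  have hcn : Continuous fun p : unitInterval × Metric.sphere (0 : E) 1 =>
      ‖F ((1 + (p.1 : ℝ)) • (p.2 : E))‖⁻¹ • F ((1 + (p.1 : ℝ)) • (p.2 : E)) :=
    (hc.norm.inv₀ fun p => norm_ne_zero_iff.2 (hF0 _ (hmem p))).smul hc
  let H : C(unitInterval × Metric.sphere (0 : E) 1, Metric.sphere (0 : E') 1) :=
    ⟨fun p => ⟨_, hn p⟩, hcn.subtype_mk hn⟩
  refine ⟨H.comp ((ContinuousMap.const _ 0).prodMk (.id _)),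
    H.comp ((ContinuousMap.const _ 1).prodMk (.id _)), fun x => ?_, fun x => ?_,
    ⟨⟨H, fun x => rfl, fun x => rfl⟩⟩⟩
  · simp [H]
  · simp [H, one_add_one_eq_two]

/-- Non-existence over the annulus `1 < ‖x‖ < 2` of solutions with strongly rescaled
sphere-valued boundary data `R·f₁`, `R·f₂` when the induced maps `Sⁿ → Sᵐ` are not
homotopic to each other. -/
theorem annulus_nonexistence_nonhomotopic (n m : ℕ) (hm : 1 ≤ m) (hnm : m < n)
    (f₁ f₂ : EuclideanSpace ℝ (Fin (n+1)) → EuclideanSpace ℝ (Fin (m+1)))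
    (V₁ : Set (EuclideanSpace ℝ (Fin (n+1)))) (hV₁open : IsOpen V₁)
    (hSV₁ : Metric.sphere (0 : EuclideanSpace ℝ (Fin (n+1))) 1 ⊆ V₁)
    (hf₁C2 : ContDiffOn ℝ 2 f₁ V₁)
    (V₂ : Set (EuclideanSpace ℝ (Fin (n+1)))) (hV₂open : IsOpen V₂)
    (hSV₂ : Metric.sphere (0 : EuclideanSpace ℝ (Fin (n+1))) 2 ⊆ V₂)
    (hf₂C2 : ContDiffOn ℝ 2 f₂ V₂)
    (hunit₁ : ∀ x ∈ Metric.sphere (0 : EuclideanSpace ℝ (Fin (n+1))) 1, ‖f₁ x‖ = 1)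
    (hunit₂ : ∀ x ∈ Metric.sphere (0 : EuclideanSpace ℝ (Fin (n+1))) 2, ‖f₂ x‖ = 1)
    -- the maps x ↦ f₁(x) and x ↦ f₂(2x), from Sⁿ(1) to Sᵐ, are not homotopic
    (hnothomotopic : ∀ g₁ g₂ : C(↥(Metric.sphere (0 : EuclideanSpace ℝ (Fin (n+1))) 1),
        ↥(Metric.sphere (0 : EuclideanSpace ℝ (Fin (m+1))) 1)),
      (∀ x, (g₁ x : EuclideanSpace ℝ (Fin (m+1))) = f₁ x) →
      (∀ x, (g₂ x : EuclideanSpace ℝ (Fin (m+1))) =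
        f₂ ((2:ℝ) • (x : EuclideanSpace ℝ (Fin (n+1))))) →
      ¬ g₁.Homotopic g₂) :
    ∃ R₀ > (0:ℝ), ∀ R ≥ R₀,
      ¬ ∃ F, IsMSSolution n m {x : EuclideanSpace ℝ (Fin (n+1)) | 1 < ‖x‖ ∧ ‖x‖ < 2}
        (fun x => if ‖x‖ ≤ (3/2 : ℝ) then R • f₁ x else R • f₂ x) F := by
  refine ⟨2 * (m + 2), by positivity, fun R hR => ?_⟩
  rintro ⟨F, hF⟩
  have hm0 : (0 : ℝ) ≤ m := Nat.cast_nonneg m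
  have hRpos : 0 < R := by linarith
  have hmem₁ : ∀ x : EuclideanSpace ℝ (Fin (n+1)), ‖x‖ = 1 →
      x ∈ frontier {x : EuclideanSpace ℝ (Fin (n+1)) | 1 < ‖x‖ ∧ ‖x‖ < 2} := fun x hx => by
    rw [isOpen_annulus.frontier_eq]
    refine ⟨?_, fun h => h.1.ne' hx⟩
    simpa using smul_mem_closure_annulus hx (t := 1) (by norm_num)
  have hmem₂ : ∀ x : EuclideanSpace ℝ (Fin (n+1)), ‖x‖ = 1 →
      (2 : ℝ) • x ∈ frontier {x : EuclideanSpace ℝ (Fin (n+1)) | 1 < ‖x‖ ∧ ‖x‖ < 2} :=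
    fun x hx => by
      rw [isOpen_annulus.frontier_eq]
      refine ⟨smul_mem_closure_annulus hx (by norm_num), fun h => h.2.ne ?_⟩
      rw [norm_smul, hx]; norm_num
  have hF₁ : ∀ x : EuclideanSpace ℝ (Fin (n+1)), ‖x‖ = 1 → F x = R • f₁ x := fun x hx => by
    refine (hF.2.2.1 x (hmem₁ x hx)).trans (if_pos ?_)
    rw [hx]; norm_num
  have hF₂ : ∀ x : EuclideanSpace ℝ (Fin (n+1)), ‖x‖ = 1 →
      F ((2 : ℝ) • x) = R • f₂ ((2 : ℝ) • x) := fun x hx => by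
    refine (hF.2.2.1 _ (hmem₂ x hx)).trans (if_neg ?_)
    rw [norm_smul, hx]; norm_num
  have hnorm : ∀ {y : EuclideanSpace ℝ (Fin (m+1))}, ‖y‖ = 1 → ‖R • y‖⁻¹ • R • y = y := by
    intro y hy
    rw [norm_smul, hy, mul_one, Real.norm_of_nonneg hRpos.le, inv_smul_smul₀ hRpos.ne']
  have hfr : ∀ x ∈ frontier {x : EuclideanSpace ℝ (Fin (n+1)) | 1 < ‖x‖ ∧ ‖x‖ < 2},
      ‖x‖ ≤ 2 ∧ ‖if ‖x‖ ≤ (3/2 : ℝ) then R • f₁ x else R • f₂ x‖ = R := by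
    intro x hx
    rcases norm_eq_of_mem_frontier_annulus hx with h | h
    · rw [if_pos (by rw [h]; norm_num), norm_smul, hunit₁ x (by simpa using h), mul_one,
        Real.norm_of_nonneg hRpos.le]
      exact ⟨by rw [h]; norm_num, rfl⟩
    · rw [if_neg (by rw [h]; norm_num), norm_smul, hunit₂ x (by simpa using h), mul_one,
        Real.norm_of_nonneg hRpos.le]
      exact ⟨h.le, rfl⟩
  have hmax := hF.mul_norm_sq_le hnm isOpen_annulus
    ((Metric.isBounded_ball (x := (0 : EuclideanSpace ℝ (Fin (n+1)))) (r := 2)).subset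
      fun x hx => by simpa using hx.2)
    fun x hx => by
      obtain ⟨h1, h2⟩ := hfr x hx
      simp only [h2]
      have h3 : ‖x‖ ^ 2 ≤ 2 ^ 2 := pow_le_pow_left₀ (norm_nonneg x) h1 2
      have h4 : (m + 2) * ‖x‖ ^ 2 ≤ (m + 2) * 2 ^ 2 :=
        mul_le_mul_of_nonneg_left h3 (by positivity)
      nlinarith
  have hF0 : ∀ x ∈ closure {x : EuclideanSpace ℝ (Fin (n+1)) | 1 < ‖x‖ ∧ ‖x‖ < 2}, F x ≠ 0 := by
    intro x hx h0
    by_cases hxΩ : 1 < ‖x‖ ∧ ‖x‖ < 2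
    · have h1 := hmax x hxΩ
      rw [h0, norm_zero] at h1
      nlinarith [hxΩ.1]
    · have hxf : x ∈ frontier {x : EuclideanSpace ℝ (Fin (n+1)) | 1 < ‖x‖ ∧ ‖x‖ < 2} := by
        rw [isOpen_annulus.frontier_eq]; exact ⟨hx, hxΩ⟩
      have h1 := (hfr x hxf).2
      have h2 := hF.2.2.1 x hxf
      simp only [h0] at h2
      rw [← h2, norm_zero] at h1
      exact hRpos.ne h1
  obtain ⟨g₁, g₂, hg₁, hg₂, hg⟩ := homotopic_of_ne_zero_on_annulus hF.1 hF0
  refine hnothomotopic g₁ g₂ (fun x => ?_) (fun x => ?_) hg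
  · rw [hg₁, hF₁ x (by simp), hnorm (hunit₁ x x.2)]
  · rw [hg₂, hF₂ x (by simp), hnorm (hunit₂ _ (by simp [norm_smul]))]
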